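/- arXiv:1708.00814 — 8 statements merged into one kernel-verified Lean document; each statement's English description precedes it below -/
import Mathlib

section
/- Let P be a finite set of n ≥ 2 point sites in the Euclidean plane and let p ∈ P. The farthest-site Voronoi cell F(p) is nonempty if and only if p does not lie in the convex hull of P \ {p}. -/
open scoped Classical

noncomputable section

abbrev Plane := EuclideanSpace ℝ (Fin 2)

/-- The farthest-site Voronoi cell of `p` with respect to the site set `P`. -/
def farCell (P : Finset Plane) (p : Plane) : Set Plane :=
  {x | ∀ q ∈ P, q ≠ p → dist x q < dist x p}

/-- Far enough from `p` against the direction `v`, a point is strictly closer to every site of a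
finite set lying strictly below `p` in direction `v` than it is to `p`. -/
theorem exists_forall_dist_lt_of_inner_pos {E : Type*} [NormedAddCommGroup E]
    [InnerProductSpace ℝ E] (s : Finset E) (p v : E) (h : ∀ q ∈ s, 0 < inner ℝ v (p - q)) :
    ∃ x, ∀ q ∈ s, dist x q < dist x p := by
  have hlarge : ∀ᶠ t : ℝ in Filter.atTop, ∀ q ∈ s, ‖p - q‖ ^ 2 < t * inner ℝ v (p - q) :=
    (Finset.eventually_all s).2 fun q hq =>
      (Filter.tendsto_id.atTop_mul_const (h q hq)).eventually_gt_atTop _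
  obtain ⟨t, ht⟩ := hlarge.exists
  refine ⟨p - (t / 2) • v, fun q hq => ?_⟩
  have hxq : p - (t / 2) • v - q = (p - q) - (t / 2) • v := by abel
  have hxp : p - (t / 2) • v - p = -((t / 2) • v) := by abel
  rw [dist_eq_norm, dist_eq_norm, hxq, hxp, norm_neg]
  refine lt_of_pow_lt_pow_left₀ 2 (norm_nonneg _) ?_
  rw [norm_sub_sq_real, real_inner_smul_right, real_inner_comm]
  linarith [ht q hq]

theorem farCell_nonempty_iff_not_mem_convexHull
    (P : Finset Plane) (hn : 2 ≤ P.card) (p : Plane) (hp : p ∈ P) :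
    (farCell P p).Nonempty ↔ p ∉ convexHull ℝ (↑(P.erase p) : Set Plane) := by
  constructor
  · rintro ⟨x, hx⟩ hmem
    have hsub : (↑(P.erase p) : Set Plane) ⊆ Metric.ball x (dist x p) := fun q hq => by
      obtain ⟨hqp, hqP⟩ := Finset.mem_erase.1 (Finset.mem_coe.1 hq)
      exact Metric.mem_ball'.2 (hx q hqP hqp)
    exact lt_irrefl _ (Metric.mem_ball'.1 (convexHull_min hsub (convex_ball _ _) hmem))
  · intro hnot
    obtain ⟨f, u, hfu, huf⟩ := geometric_hahn_banach_closed_point (convex_convexHull ℝ _)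
      ((P.erase p).finite_toSet.isClosed_convexHull ℝ) hnot
    obtain ⟨x, hx⟩ := exists_forall_dist_lt_of_inner_pos (P.erase p) p
      ((InnerProductSpace.toDual ℝ Plane).symm f) fun q hq => by
        rw [InnerProductSpace.toDual_symm_apply, map_sub]
        linarith [hfu q (subset_convexHull ℝ _ hq)]
    exact ⟨x, fun q hqP hqp => hx q (Finset.mem_erase.2 ⟨hqp, hqP⟩)⟩
end
end

section
/- Let P be a finite set of n ≥ 2 point sites in the Euclidean plane in general position, and let p, l ∈ P be distinct sites such that every site of P lies in a closed half-plane whose boundary line passes through p and l. Then the farthest-site Voronoi edge of p and l, namely the set {x ∈ ℝ² : dist(x,p) = dist(x,l) and dist(x,q) < dist(x,p) for all q ∈ P \ {p,l}}, is nonempty and unbounded. -/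
open scoped RealInnerProductSpace

noncomputable section

/-- `P` is in general position: no three sites on a common line and
no four sites on a common circle. -/
def GenPos (P : Finset Plane) : Prop :=
  (∀ a ∈ P, ∀ b ∈ P, ∀ c ∈ P, a ≠ b → a ≠ c → b ≠ c →
      ¬ Collinear ℝ ({a, b, c} : Set Plane)) ∧
  (∀ a ∈ P, ∀ b ∈ P, ∀ c ∈ P, ∀ d ∈ P,
      a ≠ b → a ≠ c → a ≠ d → b ≠ c → b ≠ d → c ≠ d →
      ¬ ∃ (o : Plane) (r : ℝ),
          dist o a = r ∧ dist o b = r ∧ dist o c = r ∧ dist o d = r)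

open Filter in
/-- Moving a point far enough along `-w` makes it closer to `q` than to `p` whenever `q` lies
strictly on the negative side of the line through `p` normal to `w`. -/
lemma eventually_dist_sub_smul_lt {E : Type*} [NormedAddCommGroup E] [InnerProductSpace ℝ E]
    (m p q w : E) (hq : ⟪w, q - p⟫ < 0) :
    ∀ᶠ t : ℝ in atTop, dist (m - t • w) q < dist (m - t • w) p := by
  filter_upwards [eventually_gt_atTop ((‖m - q‖ ^ 2 - ‖m - p‖ ^ 2) / (-(2 * ⟪w, q - p⟫)))]
    with t ht
  rw [div_lt_iff₀ (by linarith)] at ht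
  rw [dist_eq_norm, dist_eq_norm]
  refine lt_of_pow_lt_pow_left₀ 2 (norm_nonneg _) ?_
  have expand : ∀ y : E,
      ‖m - t • w - y‖ ^ 2 = ‖m - y‖ ^ 2 - 2 * (t * ⟪w, m - y⟫) + ‖t • w‖ ^ 2 := by
    intro y
    rw [sub_right_comm, norm_sub_sq_real, real_inner_smul_right, real_inner_comm]
  have hsub : ⟪w, q - p⟫ = ⟪w, m - p⟫ - ⟪w, m - q⟫ := by
    rw [← inner_sub_right]
    congr 1
    abel
  rw [expand, expand]
  rw [hsub] at ht
  linarith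

/-- In the plane, three points on a line with nonzero normal vector `w` are collinear. -/
lemma collinear_of_inner_eq_zero {p l q w : Plane} (hpl : p ≠ l) (hw : w ≠ 0)
    (hwl : ⟪w, l - p⟫ = 0) (hwq : ⟪w, q - p⟫ = 0) :
    Collinear ℝ ({p, l, q} : Set Plane) := by
  obtain ⟨r, hr⟩ : ∃ r : ℝ, q - p = r • (l - p) := by
    have hfin : Module.finrank ℝ (ℝ ∙ w)ᗮ = 1 :=
      haveI : Fact (Module.finrank ℝ Plane = 1 + 1) := ⟨by simp⟩
      Submodule.finrank_orthogonal_span_singleton hw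
    have hl : (⟨l - p, Submodule.mem_orthogonal_singleton_iff_inner_right.2 hwl⟩ :
        (ℝ ∙ w)ᗮ) ≠ 0 := by
      simpa [Subtype.ext_iff, sub_eq_zero] using hpl.symm
    obtain ⟨r, hr⟩ := (finrank_eq_one_iff_of_nonzero' _ hl).1 hfin
      ⟨q - p, Submodule.mem_orthogonal_singleton_iff_inner_right.2 hwq⟩
    exact ⟨r, (congrArg Subtype.val hr).symm⟩
  rw [collinear_iff_of_mem (Set.mem_insert p _)]
  refine ⟨l - p, ?_⟩
  rintro x (rfl | rfl | rfl)
  · exact ⟨0, by simp⟩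
  · exact ⟨1, by simp⟩
  · exact ⟨r, by rw [vadd_eq_add, ← hr, sub_add_cancel]⟩

open Filter in
/-- A set containing all far enough points of a ray is nonempty and unbounded. -/
lemma nonempty_and_not_isBounded_of_eventually_mem {E : Type*} [NormedAddCommGroup E]
    [NormedSpace ℝ E] {s : Set E} {m w : E} (hw : w ≠ 0)
    (h : ∀ᶠ t : ℝ in atTop, m - t • w ∈ s) : s.Nonempty ∧ ¬ Bornology.IsBounded s := by
  refine ⟨h.exists.imp' _ fun _ ht => ht, fun hb => ?_⟩
  obtain ⟨R, hR⟩ := hb.exists_norm_le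
  obtain ⟨t, ht, htR⟩ := (h.and (eventually_gt_atTop ((R + ‖m‖) / ‖w‖))).exists
  rw [div_lt_iff₀ (norm_pos_iff.2 hw)] at htR
  have h1 := hR _ ht
  have h2 : ‖t • w‖ ≤ ‖m‖ + ‖m - t • w‖ := by
    simpa using norm_sub_le m (m - t • w)
  have h3 : t * ‖w‖ ≤ ‖t • w‖ := by
    rw [norm_smul]
    gcongr
    exact le_abs_self t
  linarith

theorem farVoronoiEdge_nonempty_and_unbounded
    (P : Finset Plane) (hn : 2 ≤ P.card) (hgp : GenPos P)
    (p l : Plane) (hp : p ∈ P) (hl : l ∈ P) (hpl : p ≠ l)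
    -- every site of `P` lies in a closed half-plane whose boundary line passes
    -- through `p` and `l`
    (w : Plane) (hw : w ≠ 0) (hwl : ⟪w, l - p⟫ = 0)
    (hhalf : ∀ q ∈ P, ⟪w, q - p⟫ ≤ 0) :
    ({x : Plane | dist x p = dist x l ∧
        ∀ q ∈ P, q ≠ p → q ≠ l → dist x q < dist x p}).Nonempty ∧
    ¬ Bornology.IsBounded
        {x : Plane | dist x p = dist x l ∧
          ∀ q ∈ P, q ≠ p → q ≠ l → dist x q < dist x p} := by
  refine nonempty_and_not_isBounded_of_eventually_mem (m := midpoint ℝ p l) hw ?_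
  have hclose : ∀ᶠ t : ℝ in Filter.atTop, ∀ q ∈ P, q ≠ p → q ≠ l →
      dist (midpoint ℝ p l - t • w) q < dist (midpoint ℝ p l - t • w) p := by
    refine (Filter.eventually_all_finset P).2 fun q hq => ?_
    by_cases hqp : q = p
    · simp [hqp]
    by_cases hql : q = l
    · simp [hql]
    have hneg : ⟪w, q - p⟫ < 0 := (hhalf q hq).lt_of_ne fun h0 =>
      hgp.1 p hp l hl q hq hpl (Ne.symm hqp) (Ne.symm hql)
        (collinear_of_inner_eq_zero hpl hw hwl h0)
    filter_upwards [eventually_dist_sub_smul_lt (midpoint ℝ p l) p q w hneg] with t ht _ _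
    exact ht
  filter_upwards [hclose] with t ht
  refine ⟨?_, ht⟩
  rw [← AffineSubspace.mem_perpBisector_iff_dist_eq,
    AffineSubspace.mem_perpBisector_iff_inner_eq_zero]
  simp [inner_smul_left, hwl]
end
end

section
/- Let P be a finite set of n ≥ 3 point sites in the Euclidean plane in general position. Let l, p, r ∈ P be pairwise distinct sites such that every site of P lies in a closed half-plane whose boundary line passes through l and p, and every site of P lies in a closed half-plane whose boundary line passes through p and r. Let c be the circumcenter of l, p, r (the unique point equidistant from l, p and r, which exists since l, p, r are not collinear). Then c ≠ p and there exists t > 0 such that the point p + t·(c − p) lies on the topological frontier of the farthest-site Voronoi cell F(p). -/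
open scoped RealInnerProductSpace

noncomputable section

/-- Two vectors of the plane that are not proportional span it. -/
theorem exists_smul_add_smul_eq {u v : Plane} (h : LinearIndependent ℝ ![u, v]) (x : Plane) :
    ∃ a b : ℝ, a • u + b • v = x := by
  have hspan := h.span_eq_top_of_card_eq_finrank' (by simp)
  have hx : x ∈ Submodule.span ℝ (Set.range ![u, v]) := hspan ▸ Submodule.mem_top
  rw [Matrix.range_cons, Matrix.range_cons, Matrix.range_empty, Set.union_empty] at hx
  exact Submodule.mem_span_pair.1 hx

theorem linearIndependent_sub_of_not_collinear {l p r : Plane}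
    (h : ¬ Collinear ℝ ({l, p, r} : Set Plane)) :
    LinearIndependent ℝ ![l - p, r - p] := by
  have hlp : l - p ≠ 0 := by
    intro h0
    rw [sub_eq_zero.1 h0] at h
    exact h (by simpa using collinear_pair ℝ p r)
  rw [LinearIndependent.pair_iff' hlp]
  intro a ha
  refine h ((collinear_iff_of_mem (p₀ := p) (by simp)).2 ⟨l - p, ?_⟩)
  rintro x (rfl | rfl | rfl)
  · exact ⟨1, by simp⟩
  · exact ⟨0, by simp⟩
  · exact ⟨a, by simp [ha]⟩

theorem dist_add_smul_lt_iff (p q v : Plane) (t : ℝ) :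
    dist (p + t • v) q < dist (p + t • v) p ↔ ‖q - p‖ ^ 2 < 2 * t * ⟪v, q - p⟫ := by
  have h : p + t • v - q = t • v - (q - p) := by abel
  rw [dist_eq_norm, dist_eq_norm, add_sub_cancel_left, h,
    ← sq_lt_sq₀ (norm_nonneg _) (norm_nonneg _), norm_sub_sq_real, real_inner_smul_left]
  constructor <;> intro h <;> linarith

theorem two_mul_inner_sub_of_dist_eq {c x p : Plane} (h : dist c x = dist c p) :
    2 * ⟪c - p, x - p⟫ = ‖x - p‖ ^ 2 := by
  have hx : c - x = (c - p) - (x - p) := by abel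
  have h2 : ‖c - x‖ ^ 2 = ‖c - p‖ ^ 2 := by rw [← dist_eq_norm, ← dist_eq_norm, h]
  rw [hx, norm_sub_sq_real] at h2
  linarith

/-- A ray from `p` that makes an acute angle with every direction from `p` to another site
meets the frontier of the farthest-site cell of `p`. -/
theorem exists_mem_frontier_farCell {P : Finset Plane} {p v : Plane}
    (hne : ∃ q ∈ P, q ≠ p) (hv : ∀ q ∈ P, q ≠ p → 0 < ⟪v, q - p⟫) :
    ∃ t : ℝ, 0 < t ∧ p + t • v ∈ frontier (farCell P p) := by
  classical
  obtain ⟨q₀, hq₀, hmax⟩ := (P.filter (· ≠ p)).exists_max_image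
    (fun q => ‖q - p‖ ^ 2 / (2 * ⟪v, q - p⟫)) (by
      obtain ⟨q, hq, hqp⟩ := hne
      exact ⟨q, by simp [hq, hqp]⟩)
  obtain ⟨hq₀P, hq₀p⟩ := Finset.mem_filter.1 hq₀
  have hpos := hv q₀ hq₀P hq₀p
  set t₀ := ‖q₀ - p‖ ^ 2 / (2 * ⟪v, q₀ - p⟫) with ht₀
  have hnorm : 0 < ‖q₀ - p‖ := norm_pos_iff.2 (sub_ne_zero.2 hq₀p)
  refine ⟨t₀, by positivity, ?_, fun hmem => ?_⟩
  · have hcell : ∀ t ∈ Set.Ioi t₀, p + t • v ∈ farCell P p := by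
      intro t ht q hq hqp
      have hvq := hv q hq hqp
      have hlt := (hmax q (Finset.mem_filter.2 ⟨hq, hqp⟩)).trans_lt ht
      rw [div_lt_iff₀ (by positivity)] at hlt
      rw [dist_add_smul_lt_iff]
      linarith
    have hcont : Continuous fun t : ℝ => p + t • v := by fun_prop
    exact map_mem_closure (f := fun t : ℝ => p + t • v) hcont
      (by rw [closure_Ioi]; exact Set.self_mem_Ici) hcell
  · have hlt := interior_subset hmem q₀ hq₀P hq₀p
    rw [dist_add_smul_lt_iff] at hlt
    have heq : t₀ * (2 * ⟪v, q₀ - p⟫) = ‖q₀ - p‖ ^ 2 := div_mul_cancel₀ _ (by positivity)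
    linarith

/-- A nonzero linear form on the plane that vanishes on `u` and is nonpositive on `v` is
negative on `v` when `u` and `v` are independent. -/
theorem inner_neg_of_linearIndependent {u v w : Plane} (h : LinearIndependent ℝ ![u, v])
    (hw : w ≠ 0) (hu : ⟪w, u⟫ = 0) (hv : ⟪w, v⟫ ≤ 0) : ⟪w, v⟫ < 0 := by
  refine hv.lt_of_ne fun h0 => hw ?_
  obtain ⟨a, b, hab⟩ := exists_smul_add_smul_eq h w
  rw [← inner_self_eq_zero (𝕜 := ℝ)]
  nth_rewrite 2 [← hab]
  simp [inner_add_right, real_inner_smul_right, hu, h0]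

theorem ray_toward_circumcenter_meets_frontier_of_farCell
    (P : Finset Plane) (hn : 3 ≤ P.card) (hgp : GenPos P)
    (l p r : Plane) (hl : l ∈ P) (hp : p ∈ P) (hr : r ∈ P)
    (hlp : l ≠ p) (hlr : l ≠ r) (hpr : p ≠ r)
    -- every site of `P` lies in a closed half-plane whose boundary line passes
    -- through `l` and `p`
    (w₁ : Plane) (hw₁ : w₁ ≠ 0) (hw₁lp : ⟪w₁, p - l⟫ = 0)
    (hhalf₁ : ∀ q ∈ P, ⟪w₁, q - l⟫ ≤ 0)
    -- every site of `P` lies in a closed half-plane whose boundary line passes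
    -- through `p` and `r`
    (w₂ : Plane) (hw₂ : w₂ ≠ 0) (hw₂pr : ⟪w₂, r - p⟫ = 0)
    (hhalf₂ : ∀ q ∈ P, ⟪w₂, q - p⟫ ≤ 0)
    -- `c` is the circumcenter of `l`, `p`, `r`
    (c : Plane) (hcl : dist c l = dist c p) (hcr : dist c r = dist c p) :
    c ≠ p ∧ ∃ t : ℝ, 0 < t ∧ p + t • (c - p) ∈ frontier (farCell P p) := by
  have hli := linearIndependent_sub_of_not_collinear (hgp.1 l hl p hp r hr hlp hlr hpr)
  have hli' := linearIndependent_sub_of_not_collinear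
    (hgp.1 r hr p hp l hl hpr.symm hlr.symm hlp.symm)
  have hw₁l : ⟪w₁, l - p⟫ = 0 := by rw [← neg_sub, inner_neg_right, hw₁lp, neg_zero]
  have hhalf₁' : ∀ q ∈ P, ⟪w₁, q - p⟫ ≤ 0 := by
    intro q hq
    have h := hhalf₁ q hq
    rwa [← sub_add_sub_cancel q p l, inner_add_right, hw₁lp, add_zero] at h
  have hneg₁ := inner_neg_of_linearIndependent hli hw₁ hw₁l (hhalf₁' r hr)
  have hneg₂ := inner_neg_of_linearIndependent hli' hw₂ hw₂pr (hhalf₂ l hl)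
  have hcl' := two_mul_inner_sub_of_dist_eq hcl
  have hcr' := two_mul_inner_sub_of_dist_eq hcr
  have hnl : 0 < ‖l - p‖ ^ 2 := pow_pos (norm_pos_iff.2 (sub_ne_zero.2 hlp)) 2
  have hnr : 0 < ‖r - p‖ ^ 2 := pow_pos (norm_pos_iff.2 (sub_ne_zero.2 hpr.symm)) 2
  refine ⟨?_, exists_mem_frontier_farCell ⟨l, hl, hlp⟩ fun q hq hqp => ?_⟩
  · rintro rfl
    rw [sub_self, inner_zero_left, mul_zero] at hcl'
    exact hnl.ne hcl'
  · obtain ⟨a, b, hab⟩ := exists_smul_add_smul_eq hli (q - p)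
    have h₁ := hhalf₁' q hq
    have h₂ := hhalf₂ q hq
    rw [← hab, inner_add_right, real_inner_smul_right, real_inner_smul_right] at h₁ h₂ ⊢
    rw [hw₁l, mul_zero, zero_add] at h₁
    rw [hw₂pr, mul_zero, add_zero] at h₂
    have ha : 0 ≤ a := nonneg_of_mul_nonpos_left h₂ hneg₂
    have hb : 0 ≤ b := nonneg_of_mul_nonpos_left h₁ hneg₁
    have hil : 0 < ⟪c - p, l - p⟫ := by linarith
    have hir : 0 < ⟪c - p, r - p⟫ := by linarith
    rcases ha.eq_or_lt with rfl | ha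
    · rcases hb.eq_or_lt with rfl | hb
      · simp only [zero_smul, add_zero] at hab
        exact absurd (sub_eq_zero.1 hab.symm) hqp
      · positivity
    · positivity
end
end

section
/- Let P be a finite set of n point sites in the Euclidean plane, let 1 ≤ k ≤ n−2, let Q ⊆ P with |Q| = k+1, and let x ∈ C^{k+1}(Q). Then for any subset Q′ ⊆ P with |Q′| = k, the point x lies in the order-k Voronoi cell C^k(Q′) if and only if Q′ ⊆ Q and the unique site q ∈ Q \ Q′ satisfies dist(x,q′) < dist(x,q) for all q′ ∈ Q \ {q} (that is, q is the strictly farthest site of Q from x). In other words, inside the order-(k+1) cell of Q, the order-k Voronoi diagram of P coincides with the farthest-site Voronoi diagram of Q. -/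
noncomputable section

/-- The order-`|Q|` Voronoi cell of the subset `Q` of the site set `P`:
the points strictly closer to every site of `Q` than to any site of `P \ Q`. -/
def ordCell (P Q : Finset Plane) : Set Plane :=
  {x | ∀ p ∈ Q, ∀ q ∈ P, q ∉ Q → dist x p < dist x q}

theorem Finset.eq_of_mem_sdiff_of_card_eq_succ {α : Type*} {s t : Finset α} (hst : s ⊆ t)
    (hcard : t.card = s.card + 1) {a b : α} (ha : a ∈ t) (has : a ∉ s) (hb : b ∈ t)
    (hbs : b ∉ s) : a = b := by
  classical
  have h : (t \ s).card ≤ 1 := by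
    rw [Finset.card_sdiff_of_subset hst]
    omega
  exact Finset.card_le_one.mp h a (Finset.mem_sdiff.mpr ⟨ha, has⟩) b
    (Finset.mem_sdiff.mpr ⟨hb, hbs⟩)

/-- If a point lies in the cells of two sets of sites, the larger set contains the smaller one. -/
theorem subset_of_mem_ordCell {P Q Q' : Finset Plane} (hQP : Q ⊆ P) (hQ'P : Q' ⊆ P)
    (hcard : Q'.card < Q.card) {x : Plane} (hx : x ∈ ordCell P Q) (hx' : x ∈ ordCell P Q') :
    Q' ⊆ Q := by
  intro p hp
  by_contra hpQ
  obtain ⟨q, hq, hqQ'⟩ := Finset.exists_mem_notMem_of_card_lt_card hcard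
  exact lt_asymm (hx q hq p (hQ'P hp) hpQ) (hx' p hp q (hQP hq) hqQ')

theorem orderK_inside_orderKplus1_is_farthest
    (P : Finset Plane) (k : ℕ) (hk1 : 1 ≤ k) (hk2 : k + 2 ≤ P.card)
    (Q : Finset Plane) (hQP : Q ⊆ P) (hQcard : Q.card = k + 1)
    (x : Plane) (hx : x ∈ ordCell P Q)
    (Q' : Finset Plane) (hQ'P : Q' ⊆ P) (hQ'card : Q'.card = k) :
    x ∈ ordCell P Q' ↔
      Q' ⊆ Q ∧ ∃ q ∈ Q, q ∉ Q' ∧ ∀ q' ∈ Q, q' ≠ q → dist x q' < dist x q := by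
  have hsucc : Q.card = Q'.card + 1 := by omega
  constructor
  · intro hx'
    have hsub := subset_of_mem_ordCell hQP hQ'P (by omega) hx hx'
    obtain ⟨q, hq, hqQ'⟩ := Finset.exists_mem_notMem_of_card_lt_card
      (show Q'.card < Q.card by omega)
    refine ⟨hsub, q, hq, hqQ', fun q' hq' hne => hx' q' ?_ q (hQP hq) hqQ'⟩
    by_contra hq'Q'
    exact hne (Finset.eq_of_mem_sdiff_of_card_eq_succ hsub hsucc hq' hq'Q' hq hqQ')
  · rintro ⟨hsub, q, hq, hqQ', hfar⟩ p hp r hr hrQ'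
    by_cases hrQ : r ∈ Q
    · obtain rfl := Finset.eq_of_mem_sdiff_of_card_eq_succ hsub hsucc hrQ hrQ' hq hqQ'
      exact hfar p (hsub hp) (ne_of_mem_of_not_mem hp hrQ')
    · exact hx p (hsub hp) r hr hrQ
end
end

section
/- Let P be a finite set of n point sites in the Euclidean plane in general position, let 1 ≤ k ≤ n−2, and let Q₁ ≠ Q₂ be subsets of P with |Q₁| = |Q₂| = k. Suppose there exist two distinct points that both lie in closure(C^k(Q₁)) ∩ closure(C^k(Q₂)). Then |Q₁ ∪ Q₂| = k+1, the order-(k+1) Voronoi cell C^{k+1}(Q₁ ∪ Q₂) is nonempty, and closure(C^k(Q₁)) ∩ closure(C^k(Q₂)) ⊆ closure(C^{k+1}(Q₁ ∪ Q₂)). -/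
open scoped Classical

noncomputable section

theorem Plane.dist_sq (x y : Plane) :
    dist x y ^ 2 = (x 0 - y 0) ^ 2 + (x 1 - y 1) ^ 2 := by
  rw [EuclideanSpace.dist_eq, Real.sq_sqrt (by positivity)]
  simp [Fin.sum_univ_two, Real.dist_eq, sq_abs]

/-- The difference of the squared distances to two fixed points is an affine function. -/
theorem Plane.dist_sq_sub_dist_sq_lineMap (u v a b : Plane) (t : ℝ) :
    dist (AffineMap.lineMap u v t) b ^ 2 - dist (AffineMap.lineMap u v t) a ^ 2 =
      (1 - t) * (dist u b ^ 2 - dist u a ^ 2) + t * (dist v b ^ 2 - dist v a ^ 2) := by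
  simp only [Plane.dist_sq, AffineMap.lineMap_apply, vsub_eq_sub, vadd_eq_add, PiLp.add_apply,
    PiLp.smul_apply, PiLp.sub_apply, smul_eq_mul]
  ring

theorem Plane.dist_lineMap_lt_of_le_of_lt {u v a b : Plane} {t : ℝ} (ht : 0 < t) (ht1 : t ≤ 1)
    (hu : dist u a ≤ dist u b) (hv : dist v a < dist v b) :
    dist (AffineMap.lineMap u v t) a < dist (AffineMap.lineMap u v t) b := by
  refine lt_of_pow_lt_pow_left₀ 2 dist_nonneg ?_
  have h := Plane.dist_sq_sub_dist_sq_lineMap u v a b t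
  have hu2 : dist u a ^ 2 ≤ dist u b ^ 2 := by gcongr
  have hv2 : dist v a ^ 2 < dist v b ^ 2 := by gcongr
  have h1 := mul_nonneg (sub_nonneg.2 ht1) (sub_nonneg.2 hu2)
  have h2 := mul_pos ht (sub_pos.2 hv2)
  linarith

/-- Points at equal distance from the elements of a triple, seen from two distinct centres,
are collinear. -/
theorem Plane.collinear_of_dist_eq {x y a b c : Plane} (hxy : x ≠ y)
    (hxb : dist x a = dist x b) (hxc : dist x a = dist x c)
    (hyb : dist y a = dist y b) (hyc : dist y a = dist y c) :
    Collinear ℝ ({a, b, c} : Set Plane) := by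
  have hd : (x 0 - y 0) ^ 2 + (x 1 - y 1) ^ 2 ≠ 0 := by
    rw [← Plane.dist_sq]
    exact pow_ne_zero 2 (dist_ne_zero.2 hxy)
  have key : ∀ w : Plane, dist x a = dist x w → dist y a = dist y w →
      ∃ r : ℝ, w = r • (!₂[-(x 1 - y 1), x 0 - y 0] : Plane) +ᵥ a := by
    intro w h1 h2
    have e1 : dist x a ^ 2 = dist x w ^ 2 := by rw [h1]
    have e2 : dist y a ^ 2 = dist y w ^ 2 := by rw [h2]
    rw [Plane.dist_sq, Plane.dist_sq] at e1 e2
    refine ⟨((w 1 - a 1) * (x 0 - y 0) - (w 0 - a 0) * (x 1 - y 1)) /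
      ((x 0 - y 0) ^ 2 + (x 1 - y 1) ^ 2), ?_⟩
    have horth : (w 0 - a 0) * (x 0 - y 0) + (w 1 - a 1) * (x 1 - y 1) = 0 := by
      linear_combination (e1 - e2) / 2
    ext i
    fin_cases i
    · simp
      field_simp
      linear_combination (x 0 - y 0) * horth
    · simp
      field_simp
      linear_combination (x 1 - y 1) * horth
  rw [collinear_iff_of_mem (p₀ := a) (by simp)]
  refine ⟨!₂[-(x 1 - y 1), x 0 - y 0], ?_⟩
  rintro w (rfl | rfl | rfl)
  · exact ⟨0, by simp⟩
  · exact key _ hxb hyb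
  · exact key _ hxc hyc

theorem dist_le_of_mem_closure_ordCell {P Q : Finset Plane} {z : Plane}
    (hz : z ∈ closure (ordCell P Q)) {p q : Plane} (hp : p ∈ Q) (hq : q ∈ P) (hqQ : q ∉ Q) :
    dist z p ≤ dist z q := by
  have hcl : IsClosed {w : Plane | dist w p ≤ dist w q} :=
    isClosed_le (by fun_prop) (by fun_prop)
  exact closure_minimal (fun w hw => (hw p hp q hq hqQ).le) hcl hz

/-- If a cell contains a point, then its closure contains every point satisfying the
corresponding weak inequalities. -/
theorem mem_closure_ordCell_of_dist_le {P Q : Finset Plane} {m z : Plane} (hm : m ∈ ordCell P Q)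
    (hz : ∀ p ∈ Q, ∀ q ∈ P, q ∉ Q → dist z p ≤ dist z q) : z ∈ closure (ordCell P Q) := by
  have hlim : Filter.Tendsto (fun t : ℝ => AffineMap.lineMap z m t)
      (nhdsWithin 0 (Set.Ioi 0)) (nhds z) := by
    have hc : Continuous (fun t : ℝ => (AffineMap.lineMap z m t : Plane)) :=
      AffineMap.lineMap_continuous
    simpa using (hc.tendsto 0).mono_left nhdsWithin_le_nhds
  refine mem_closure_of_tendsto hlim ?_
  filter_upwards [Ioc_mem_nhdsGT (zero_lt_one' ℝ)] with t ht p hp q hq hqQ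
  exact Plane.dist_lineMap_lt_of_le_of_lt ht.1 ht.2 (hz p hp q hq hqQ) (hm p hp q hq hqQ)

theorem adjacent_orderK_cells_give_orderKplus1_cell
    (P : Finset Plane) (hgp : GenPos P)
    (k : ℕ) (hk1 : 1 ≤ k) (hk2 : k + 2 ≤ P.card)
    (Q₁ Q₂ : Finset Plane) (hQ₁ : Q₁ ⊆ P) (hQ₂ : Q₂ ⊆ P)
    (hc₁ : Q₁.card = k) (hc₂ : Q₂.card = k) (hne : Q₁ ≠ Q₂)
    (x y : Plane) (hxy : x ≠ y)
    (hx : x ∈ closure (ordCell P Q₁) ∩ closure (ordCell P Q₂))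
    (hy : y ∈ closure (ordCell P Q₁) ∩ closure (ordCell P Q₂)) :
    (Q₁ ∪ Q₂).card = k + 1 ∧
    (ordCell P (Q₁ ∪ Q₂)).Nonempty ∧
    closure (ordCell P Q₁) ∩ closure (ordCell P Q₂) ⊆
      closure (ordCell P (Q₁ ∪ Q₂)) := by
  have hcard : (Q₁ \ Q₂).card = (Q₂ \ Q₁).card :=
    Finset.card_sdiff_comm (hc₁.trans hc₂.symm)
  have heq : ∀ z ∈ closure (ordCell P Q₁) ∩ closure (ordCell P Q₂),
      ∀ p ∈ Q₁ \ Q₂, ∀ q ∈ Q₂ \ Q₁, dist z p = dist z q := by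
    intro z hz p hp q hq
    rw [Finset.mem_sdiff] at hp hq
    exact le_antisymm (dist_le_of_mem_closure_ordCell hz.1 hp.1 (hQ₂ hq.1) hq.2)
      (dist_le_of_mem_closure_ordCell hz.2 hq.1 (hQ₁ hp.1) hp.2)
  have hpos : 0 < (Q₁ \ Q₂).card := by
    rw [Finset.card_pos, Finset.sdiff_nonempty]
    exact fun h => hne (Finset.eq_of_subset_of_card_le h (hc₂.trans hc₁.symm).le)
  have hle : (Q₁ \ Q₂).card ≤ 1 := by
    by_contra! h
    obtain ⟨p, hp, p', hp', hpp⟩ := Finset.one_lt_card.1 h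
    obtain ⟨q, hq, q', hq', hqq⟩ := Finset.one_lt_card.1 (hcard ▸ h)
    have e1 := heq x hx p hp q hq
    have e2 := heq x hx p' hp' q hq
    have e3 := heq x hx p hp q' hq'
    rw [Finset.mem_sdiff] at hp hp' hq hq'
    have hdiff : ∀ {a b : Plane}, a ∈ Q₁ → b ∉ Q₁ → a ≠ b := fun ha hb h => hb (h ▸ ha)
    exact hgp.2 p (hQ₁ hp.1) p' (hQ₁ hp'.1) q (hQ₂ hq.1) q' (hQ₂ hq'.1) hpp
      (hdiff hp.1 hq.2) (hdiff hp.1 hq'.2) (hdiff hp'.1 hq.2) (hdiff hp'.1 hq'.2) hqq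
      ⟨x, dist x p, rfl, e2.trans e1.symm, e1.symm, e3.symm⟩
  obtain ⟨p, hp⟩ := Finset.card_pos.1 hpos
  obtain ⟨q, hq⟩ := Finset.card_pos.1 (hcard ▸ hpos)
  have hp' := Finset.mem_sdiff.1 hp
  have hq' := Finset.mem_sdiff.1 hq
  have hQ₁p : ∀ a ∈ Q₁, a ∉ Q₂ → a = p := fun a ha ha' =>
    Finset.card_le_one.1 hle a (Finset.mem_sdiff.2 ⟨ha, ha'⟩) p hp
  have hweak : ∀ z ∈ closure (ordCell P Q₁) ∩ closure (ordCell P Q₂),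
      ∀ a ∈ Q₁ ∪ Q₂, ∀ s ∈ P, s ∉ Q₁ ∪ Q₂ → dist z a ≤ dist z s := by
    intro z hz a ha s hs hsQ
    rw [Finset.mem_union, not_or] at hsQ
    rcases Finset.mem_union.1 ha with h | h
    · exact dist_le_of_mem_closure_ordCell hz.1 h hs hsQ.1
    · exact dist_le_of_mem_closure_ordCell hz.2 h hs hsQ.2
  have hstrict : ∀ a ∈ Q₁ ∪ Q₂, ∀ s ∈ P, s ∉ Q₁ ∪ Q₂ →
      dist x a < dist x s ∨ dist y a < dist y s := by
    intro a ha s hs hsQ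
    by_contra! h
    have hsQ' := hsQ
    rw [Finset.mem_union, not_or] at hsQ'
    obtain ⟨b, hb, hba, hbx, hby⟩ : ∃ b ∈ Q₁ ∪ Q₂, a ≠ b ∧
        dist x a ≤ dist x b ∧ dist y a ≤ dist y b := by
      by_cases haQ : a ∈ Q₂
      · exact ⟨p, Finset.mem_union_left _ hp'.1, fun e => hp'.2 (e ▸ haQ),
          dist_le_of_mem_closure_ordCell hx.2 haQ (hQ₁ hp'.1) hp'.2,
          dist_le_of_mem_closure_ordCell hy.2 haQ (hQ₁ hp'.1) hp'.2⟩
      · have hap : a = p := hQ₁p a ((Finset.mem_union.1 ha).resolve_right haQ) haQ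
        exact ⟨q, Finset.mem_union_right _ hq'.1, fun e => haQ (e ▸ hq'.1),
          (hap ▸ heq x hx p hp q hq).le, (hap ▸ heq y hy p hp q hq).le⟩
    have hbsx := hweak x hx b hb s hs hsQ
    have hbsy := hweak y hy b hb s hs hsQ
    have hQP := Finset.union_subset hQ₁ hQ₂
    exact hgp.1 a (hQP ha) b (hQP hb) s hs hba (fun e => hsQ (e ▸ ha)) (fun e => hsQ (e ▸ hb))
      (Plane.collinear_of_dist_eq hxy (hbx.antisymm (hbsx.trans h.1))
        ((hbx.trans hbsx).antisymm h.1) (hby.antisymm (hbsy.trans h.2))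
        ((hby.trans hbsy).antisymm h.2))
  have hmid : AffineMap.lineMap x y (1 / 2 : ℝ) ∈ ordCell P (Q₁ ∪ Q₂) := by
    intro a ha s hs hsQ
    rcases hstrict a ha s hs hsQ with h | h
    · rw [← AffineMap.lineMap_apply_one_sub]
      exact Plane.dist_lineMap_lt_of_le_of_lt (by norm_num) (by norm_num)
        (hweak y hy a ha s hs hsQ) h
    · exact Plane.dist_lineMap_lt_of_le_of_lt (by norm_num) (by norm_num)
        (hweak x hx a ha s hs hsQ) h
  refine ⟨?_, ⟨_, hmid⟩, fun z hz => mem_closure_ordCell_of_dist_le hmid (hweak z hz)⟩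
  have := Finset.card_sdiff_add_card Q₁ Q₂
  omega
end
end

section
/- Let P be a finite set of n point sites in the Euclidean plane, let v ∈ ℝ² and r > 0, and suppose the set S = {p ∈ P : dist(v,p) = r} has exactly 3 elements and the set D = {p ∈ P : dist(v,p) < r} has exactly j elements. Then for every s ∈ S, the point v lies in the closure of the order-(j+1) Voronoi cell C^{j+1}(D ∪ {s}), and for every s ∈ S, the point v lies in the closure of the order-(j+2) Voronoi cell C^{j+2}((D ∪ S) \ {s}); in particular, v lies in the closures of three pairwise distinct nonempty order-(j+1) cells and of three pairwise distinct nonempty order-(j+2) cells. -/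
open scoped Classical

noncomputable section

/-- A point `v` is in the closure of a Voronoi cell as soon as there is a direction `u` along which
every tie at `v` between a site of `Q` and a site outside `Q` is broken in favour of `Q`. -/
lemma mem_closure_ordCell_of_direction {P Q : Finset Plane} {v : Plane} (u : Plane)
    (h : ∀ p ∈ Q, ∀ q ∈ P, q ∉ Q → dist v p < dist v q ∨
      (dist v p = dist v q ∧ inner ℝ u (q - v) < inner ℝ u (p - v))) :
    v ∈ closure (ordCell P Q) := by
  have hcont : Continuous fun t : ℝ => v + t • u := by fun_prop
  have hlim : Filter.Tendsto (fun t : ℝ => v + t • u) (nhdsWithin 0 (Set.Ioi 0)) (nhds v) := by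
    simpa using (hcont.tendsto 0).mono_left nhdsWithin_le_nhds
  refine mem_closure_of_tendsto hlim ?_
  simp only [ordCell, Set.mem_ofPred_eq]
  refine (Filter.eventually_all_finset Q).2 fun p hp =>
    (Filter.eventually_all_finset P).2 fun q hq => ?_
  by_cases hqQ : q ∈ Q
  · simp [hqQ]
  rcases h p hp q hq hqQ with hlt | ⟨heq, hin⟩
  · filter_upwards [(hlim.dist tendsto_const_nhds).eventually_lt
      (hlim.dist tendsto_const_nhds) hlt] with t ht _ using ht
  · filter_upwards [self_mem_nhdsWithin] with t ht _
    have ht : 0 < t := ht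
    have expand (a : Plane) : dist (v + t • u) a ^ 2 =
        dist v a ^ 2 - 2 * t * inner ℝ u (a - v) + ‖t • u‖ ^ 2 := by
      rw [dist_eq_norm, show v + t • u - a = t • u - (a - v) by abel, norm_sub_sq_real,
        real_inner_smul_left, dist_comm v a, dist_eq_norm]
      ring
    refine lt_of_pow_lt_pow_left₀ 2 dist_nonneg ?_
    rw [expand, expand, heq]
    nlinarith [mul_lt_mul_of_pos_left hin ht]

/-- For two distinct points `s`, `q` on a sphere centred at `v`, the inner product of `s - v` with
`q - v` is smaller than that of `s - v` with itself. -/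
lemma inner_sub_center_lt_self {v s q : Plane} (hsq : dist v s = dist v q) (hne : q ≠ s) :
    inner ℝ (s - v) (q - v) < inner ℝ (s - v) (s - v) := by
  have hnorm : ‖q - v‖ = ‖s - v‖ := by
    rw [← dist_eq_norm, ← dist_eq_norm, dist_comm q, dist_comm s, hsq]
  have hpos : 0 < ‖(s - v) - (q - v)‖ ^ 2 := by
    have : (s - v) - (q - v) ≠ 0 := by simpa [sub_eq_zero] using hne.symm
    positivity
  rw [norm_sub_sq_real, hnorm] at hpos
  rw [real_inner_self_eq_norm_sq]
  linarith

theorem vertex_in_closures_of_three_cells_of_two_orders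
    (P : Finset Plane) (v : Plane) (r : ℝ) (hr : 0 < r) (j : ℕ)
    (hS : (P.filter fun p => dist v p = r).card = 3)
    (hD : (P.filter fun p => dist v p < r).card = j) :
    (∀ s ∈ P.filter fun p => dist v p = r,
        v ∈ closure (ordCell P (insert s (P.filter fun p => dist v p < r))) ∧
        (ordCell P (insert s (P.filter fun p => dist v p < r))).Nonempty) ∧
    (∀ s ∈ P.filter fun p => dist v p = r,
        v ∈ closure (ordCell P
            (((P.filter fun p => dist v p < r) ∪ (P.filter fun p => dist v p = r)).erase s)) ∧
        (ordCell P
            (((P.filter fun p => dist v p < r) ∪ (P.filter fun p => dist v p = r)).erase s)).Nonempty) ∧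
    (∀ s ∈ P.filter fun p => dist v p = r, ∀ t ∈ P.filter fun p => dist v p = r,
        s ≠ t →
        insert s (P.filter fun p => dist v p < r) ≠
          insert t (P.filter fun p => dist v p < r) ∧
        ((P.filter fun p => dist v p < r) ∪ (P.filter fun p => dist v p = r)).erase s ≠
          ((P.filter fun p => dist v p < r) ∪ (P.filter fun p => dist v p = r)).erase t) := by
  refine ⟨fun s hs => ?_, fun s hs => ?_, fun s hs t ht hst => ⟨fun h => ?_, fun h => ?_⟩⟩
  · have hsr := (Finset.mem_filter.1 hs).2
    suffices h : v ∈ closure (ordCell P (insert s (P.filter fun p => dist v p < r))) from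
      ⟨h, closure_nonempty_iff.1 ⟨v, h⟩⟩
    refine mem_closure_ordCell_of_direction (s - v) fun p hp q hq hqQ => ?_
    simp only [Finset.mem_insert, Finset.mem_filter, hq, true_and, not_or, not_lt] at hp hqQ
    obtain ⟨hqs, hqr⟩ := hqQ
    rcases hp with rfl | ⟨-, hpr⟩
    · rcases hqr.lt_or_eq with hlt | heq
      · exact Or.inl (hsr.trans_lt hlt)
      · exact Or.inr ⟨hsr.trans heq, inner_sub_center_lt_self (hsr.trans heq) hqs⟩
    · exact Or.inl (hpr.trans_le hqr)
  · have hsr := (Finset.mem_filter.1 hs).2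
    suffices h : v ∈ closure (ordCell P (((P.filter fun p => dist v p < r) ∪
        (P.filter fun p => dist v p = r)).erase s)) from
      ⟨h, closure_nonempty_iff.1 ⟨v, h⟩⟩
    refine mem_closure_ordCell_of_direction (-(s - v)) fun p hp q hq hqQ => ?_
    simp only [Finset.mem_erase, Finset.mem_union, Finset.mem_filter, ← and_or_left,
      ← le_iff_lt_or_eq, hq, true_and, not_and, not_le] at hp hqQ
    obtain ⟨hps, -, hpr⟩ := hp
    by_cases hqs : q = s
    · subst hqs
      rcases hpr.lt_or_eq with hlt | heq
      · exact Or.inl (hlt.trans_eq hsr.symm)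
      · refine Or.inr ⟨heq.trans hsr.symm, ?_⟩
        rw [inner_neg_left, inner_neg_left, neg_lt_neg_iff]
        exact inner_sub_center_lt_self (hsr.trans heq.symm) hps
    · exact Or.inl (hpr.trans_lt (hqQ hqs))
  · have hmem := h ▸ Finset.mem_insert_self s (P.filter fun p => dist v p < r)
    rcases Finset.mem_insert.1 hmem with hmem | hmem
    · exact hst hmem
    · exact (Finset.mem_filter.1 hmem).2.ne (Finset.mem_filter.1 hs).2
  · exact Finset.notMem_erase s _
      (h ▸ Finset.mem_erase.2 ⟨hst, Finset.mem_union_right _ hs⟩)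
end
end

section
/- Let P be a finite set of n point sites in the Euclidean plane in general position, let 1 ≤ k ≤ n−1, and suppose a point v ∈ ℝ² lies in the closures of three pairwise distinct order-k Voronoi cells C^k(Q₁), C^k(Q₂), C^k(Q₃). Then there exists r > 0 such that exactly three sites of P are at distance exactly r from v, and the number of sites of P at distance strictly less than r from v is either k−2 or k−1. -/
open scoped Classical

noncomputable section

/-- On the closure of a Voronoi cell the defining inequalities hold weakly. -/
theorem dist_le_dist_of_mem_closure_ordCell {P Q : Finset Plane} {v p q : Plane}
    (hv : v ∈ closure (ordCell P Q)) (hp : p ∈ Q) (hq : q ∈ P) (hqQ : q ∉ Q) :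
    dist v p ≤ dist v q := by
  have hclosed : IsClosed {x : Plane | dist x p ≤ dist x q} :=
    isClosed_le (by fun_prop) (by fun_prop)
  exact closure_minimal (fun x hx => (hx p hp q hq hqQ).le) hclosed hv

/-- At most three sites in general position lie on a common circle. -/
theorem GenPos.card_filter_dist_eq_le_three {P : Finset Plane} (hP : GenPos P) (v : Plane) (r : ℝ) :
    (P.filter fun p => dist v p = r).card ≤ 3 := by
  by_contra! h
  obtain ⟨S, hS, hS4⟩ := Finset.exists_subset_card_eq (Nat.succ_le_of_lt h)
  obtain ⟨a, b, c, d, hab, hac, had, hbc, hbd, hcd, rfl⟩ := Finset.card_eq_four.mp hS4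
  simp only [Finset.insert_subset_iff, Finset.singleton_subset_iff, Finset.mem_filter] at hS
  obtain ⟨⟨haP, ha⟩, ⟨hbP, hb⟩, ⟨hcP, hc⟩, hdP, hd⟩ := hS
  exact hP.2 a haP b hbP c hcP d hdP hab hac had hbc hbd hcd ⟨v, r, ha, hb, hc, hd⟩

theorem eq_three_of_three_le_choose {b j : ℕ} (hb : b ≤ 3) (hj : 1 ≤ j) (h : 3 ≤ b.choose j) :
    b = 3 ∧ (j = 1 ∨ j = 2) := by
  have hjb : j ≤ b := by
    by_contra! hlt
    rw [Nat.choose_eq_zero_of_lt hlt] at h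
    omega
  have hj3 : j ≤ 3 := hjb.trans hb
  clear hjb
  revert h
  interval_cases b <;> interval_cases j <;> decide

/-- If the closed disk about `v` of radius `r` holds at least `|Q|` sites and the open one fewer,
then a cell whose closure contains `v` has all sites of the open disk among its sites, and the
others on the bounding circle. -/
theorem eq_filter_union_of_mem_closure_ordCell {P Q : Finset Plane} {v : Plane} {r : ℝ}
    (hQ : Q ⊆ P) (hv : v ∈ closure (ordCell P Q))
    (hlt : (P.filter fun p => dist v p < r).card < Q.card)
    (hle : Q.card ≤ (P.filter fun p => dist v p ≤ r).card) :
    Q = (P.filter fun p => dist v p < r) ∪ (Q ∩ P.filter fun p => dist v p = r) := by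
  have hin : ∀ q ∈ P, dist v q < r → q ∈ Q := by
    intro q hq hqr
    by_contra hqQ
    refine hlt.not_ge (Finset.card_le_card fun p hp => Finset.mem_filter.mpr ⟨hQ hp, ?_⟩)
    exact (dist_le_dist_of_mem_closure_ordCell hv hp hq hqQ).trans_lt hqr
  have hout : ∀ q ∈ Q, dist v q ≤ r := by
    intro q hq
    by_contra! hqr
    refine hle.not_gt (Finset.card_lt_card (Finset.ssubset_iff_subset_ne.mpr ⟨fun p hp => ?_, ?_⟩))
    · obtain ⟨hpP, hpr⟩ := Finset.mem_filter.mp hp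
      by_contra hpQ
      exact absurd (dist_le_dist_of_mem_closure_ordCell hv hq hpP hpQ) (hpr.trans_lt hqr).not_ge
    · rintro rfl
      exact hqr.not_ge (Finset.mem_filter.mp hq).2
  ext q
  simp only [Finset.mem_union, Finset.mem_filter, Finset.mem_inter]
  constructor
  · intro hq
    rcases (hout q hq).lt_or_eq with h | h
    · exact Or.inl ⟨hQ hq, h⟩
    · exact Or.inr ⟨hq, hQ hq, h⟩
  · rintro (⟨hq, h⟩ | ⟨hq, -⟩)
    · exact hin q hq h
    · exact hq

theorem orderK_vertex_has_witness_disk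
    (P : Finset Plane) (hgp : GenPos P)
    (k : ℕ) (hk1 : 1 ≤ k) (hk2 : k + 1 ≤ P.card)
    (Q₁ Q₂ Q₃ : Finset Plane) (hQ₁ : Q₁ ⊆ P) (hQ₂ : Q₂ ⊆ P) (hQ₃ : Q₃ ⊆ P)
    (hc₁ : Q₁.card = k) (hc₂ : Q₂.card = k) (hc₃ : Q₃.card = k)
    (h12 : Q₁ ≠ Q₂) (h13 : Q₁ ≠ Q₃) (h23 : Q₂ ≠ Q₃)
    (v : Plane)
    (hv₁ : v ∈ closure (ordCell P Q₁))
    (hv₂ : v ∈ closure (ordCell P Q₂))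
    (hv₃ : v ∈ closure (ordCell P Q₃)) :
    ∃ r : ℝ, 0 < r ∧
      (P.filter fun p => dist v p = r).card = 3 ∧
      ((P.filter fun p => dist v p < r).card + 1 = k ∨
        (P.filter fun p => dist v p < r).card + 2 = k) := by
  obtain ⟨p₀, hp₀, hmax⟩ := Q₁.exists_max_image (dist v) (Finset.card_pos.mp (by omega))
  set r := dist v p₀ with hr
  set I := P.filter fun p => dist v p < r with hI
  set B := P.filter fun p => dist v p = r with hB
  have hlt : I.card < k := by
    rw [← hc₁]
    refine Finset.card_lt_card (Finset.ssubset_iff_subset_ne.mpr ⟨fun q hq => ?_, ?_⟩)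
    · obtain ⟨hqP, hqr⟩ := Finset.mem_filter.mp hq
      by_contra hqQ
      exact absurd (dist_le_dist_of_mem_closure_ordCell hv₁ hp₀ hqP hqQ) hqr.not_ge
    · intro h
      rw [← h] at hp₀
      exact lt_irrefl _ (Finset.mem_filter.mp hp₀).2
  have hle : k ≤ (P.filter fun p => dist v p ≤ r).card := by
    rw [← hc₁]
    exact Finset.card_le_card fun q hq => Finset.mem_filter.mpr ⟨hQ₁ hq, hmax q hq⟩
  have e₁ : Q₁ = I ∪ (Q₁ ∩ B) :=
    eq_filter_union_of_mem_closure_ordCell hQ₁ hv₁ (hc₁.symm ▸ hlt) (hc₁.symm ▸ hle)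
  have e₂ : Q₂ = I ∪ (Q₂ ∩ B) :=
    eq_filter_union_of_mem_closure_ordCell hQ₂ hv₂ (hc₂.symm ▸ hlt) (hc₂.symm ▸ hle)
  have e₃ : Q₃ = I ∪ (Q₃ ∩ B) :=
    eq_filter_union_of_mem_closure_ordCell hQ₃ hv₃ (hc₃.symm ▸ hlt) (hc₃.symm ▸ hle)
  have hIB : Disjoint I B :=
    Finset.disjoint_filter.mpr fun _ _ h h' => h.ne h'
  have hmem : ∀ Q : Finset Plane, Q = I ∪ (Q ∩ B) → Q.card = k →
      Q ∩ B ∈ B.powersetCard (k - I.card) := by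
    intro Q hQ hQk
    have hcard := Finset.card_union_of_disjoint (hIB.mono_right (Finset.inter_subset_right (s₁ := Q)))
    rw [← hQ] at hcard
    exact Finset.mem_powersetCard.mpr ⟨Finset.inter_subset_right, by omega⟩
  have hthree : ({Q₁ ∩ B, Q₂ ∩ B, Q₃ ∩ B} : Finset (Finset Plane)).card = 3 := by
    refine Finset.card_eq_three.mpr ⟨_, _, _, fun h => h12 ?_, fun h => h13 ?_, fun h => h23 ?_, rfl⟩
    · rw [e₁, h, ← e₂]
    · rw [e₁, h, ← e₃]
    · rw [e₂, h, ← e₃]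
  have hchoose : 3 ≤ B.card.choose (k - I.card) := by
    rw [← hthree, ← Finset.card_powersetCard]
    refine Finset.card_le_card ?_
    simp only [Finset.insert_subset_iff, Finset.singleton_subset_iff]
    exact ⟨hmem _ e₁ hc₁, hmem _ e₂ hc₂, hmem _ e₃ hc₃⟩
  have hB3 : B.card ≤ 3 := hgp.card_filter_dist_eq_le_three v r
  obtain ⟨hBcard, hj⟩ := eq_three_of_three_le_choose hB3 (by omega) hchoose
  have hcount : I.card + 1 = k ∨ I.card + 2 = k := by omega
  refine ⟨r, dist_nonneg.lt_of_ne fun h0 => ?_, hBcard, hcount⟩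
  have hBv : B ⊆ {v} := fun p hp =>
    Finset.mem_singleton.mpr (dist_eq_zero.mp ((Finset.mem_filter.mp hp).2.trans h0.symm)).symm
  have := Finset.card_le_card hBv
  rw [Finset.card_singleton] at this
  omega
end
end

section
/- Let P be a finite set of n point sites in the Euclidean plane, let 1 ≤ k ≤ n−1, and let Q₁ ≠ Q₂ be subsets of P with |Q₁| = |Q₂| = k such that the order-k Voronoi cells C^k(Q₁) and C^k(Q₂) are both nonempty. Then the centroids of Q₁ and Q₂ are distinct: (1/k)·Σ_{q∈Q₁} q ≠ (1/k)·Σ_{q∈Q₂} q. -/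
noncomputable section

open Finset in
/-- If `f` is smaller on `s` than on `t \ s`, then `s` has a strictly smaller `f`-sum than any
other set `t` of the same cardinality. -/
theorem Finset.sum_lt_sum_of_card_eq_of_forall_lt {α : Type*} {s t : Finset α} {f : α → ℝ}
    (hcard : s.card = t.card) (hne : s ≠ t) (hlt : ∀ a ∈ s, ∀ b ∈ t, b ∉ s → f a < f b) :
    ∑ a ∈ s, f a < ∑ b ∈ t, f b := by
  classical
  rw [← sum_sdiff_lt_sum_sdiff]
  have hcard' : (s \ t).card = (t \ s).card := card_sdiff_comm hcard
  have hs : (s \ t).Nonempty :=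
    sdiff_nonempty.2 fun h => hne (eq_of_subset_of_card_le h hcard.ge)
  have ht : (t \ s).Nonempty := card_pos.1 (hcard' ▸ card_pos.2 hs)
  obtain ⟨c, hc, hmax⟩ := exists_max_image (s \ t) f hs
  calc ∑ a ∈ s \ t, f a ≤ (s \ t).card • f c := sum_le_card_nsmul _ _ _ hmax
    _ = ∑ _b ∈ t \ s, f c := by rw [hcard', sum_const]
    _ < ∑ b ∈ t \ s, f b := sum_lt_sum_of_nonempty ht fun b hb =>
        hlt c (mem_sdiff.1 hc).1 b (mem_sdiff.1 hb).1 (mem_sdiff.1 hb).2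

theorem sum_dist_sq_eq {E : Type*} [NormedAddCommGroup E] [InnerProductSpace ℝ E]
    (x : E) (s : Finset E) :
    ∑ q ∈ s, dist x q ^ 2 =
      s.card * ‖x‖ ^ 2 - 2 * inner ℝ x (∑ q ∈ s, q) + ∑ q ∈ s, ‖q‖ ^ 2 := by
  simp_rw [dist_eq_norm, norm_sub_sq_real, Finset.sum_add_distrib, Finset.sum_sub_distrib,
    ← Finset.mul_sum, inner_sum, Finset.sum_const, nsmul_eq_mul]

/-- If two sets of sites have the same cardinality and the same sum, and the first one has a
nonempty cell, then it has the smaller sum of squared norms. -/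
theorem sum_norm_sq_lt_of_ordCell_nonempty {P Q R : Finset Plane} (hR : R ⊆ P)
    (hcard : Q.card = R.card) (hne : Q ≠ R) (hsum : ∑ q ∈ Q, q = ∑ q ∈ R, q)
    (h : (ordCell P Q).Nonempty) :
    ∑ q ∈ Q, ‖q‖ ^ 2 < ∑ q ∈ R, ‖q‖ ^ 2 := by
  obtain ⟨x, hx⟩ := h
  have hlt : ∑ q ∈ Q, dist x q ^ 2 < ∑ q ∈ R, dist x q ^ 2 :=
    Finset.sum_lt_sum_of_card_eq_of_forall_lt hcard hne fun p hp q hq hqQ =>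
      pow_lt_pow_left₀ (hx p hp q (hR hq) hqQ) dist_nonneg two_ne_zero
  rw [sum_dist_sq_eq, sum_dist_sq_eq, hcard, hsum] at hlt
  linarith

theorem centroids_of_nonempty_orderK_cells_distinct
    (P : Finset Plane) (k : ℕ) (hk1 : 1 ≤ k) (hk2 : k + 1 ≤ P.card)
    (Q₁ Q₂ : Finset Plane) (hQ₁ : Q₁ ⊆ P) (hQ₂ : Q₂ ⊆ P)
    (hc₁ : Q₁.card = k) (hc₂ : Q₂.card = k) (hne : Q₁ ≠ Q₂)
    (h₁ : (ordCell P Q₁).Nonempty) (h₂ : (ordCell P Q₂).Nonempty) :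
    (k : ℝ)⁻¹ • ∑ q ∈ Q₁, q ≠ (k : ℝ)⁻¹ • ∑ q ∈ Q₂, q := by
  intro heq
  have hk : (k : ℝ)⁻¹ ≠ 0 := inv_ne_zero (Nat.cast_ne_zero.2 (by lia))
  have hsum : ∑ q ∈ Q₁, q = ∑ q ∈ Q₂, q := smul_right_injective Plane hk heq
  have hcard : Q₁.card = Q₂.card := hc₁.trans hc₂.symm
  exact lt_asymm (sum_norm_sq_lt_of_ordCell_nonempty hQ₂ hcard hne hsum h₁)
    (sum_norm_sq_lt_of_ordCell_nonempty hQ₁ hcard.symm hne.symm hsum.symm h₂)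
end
end
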